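/- If K ⊆ [0,1]ⁿ is a homogeneous compact set, then its Hausdorff dimension equals its upper box dimension: dim K = upper box dimension of K. -/

import Mathlib

open Set Metric MeasureTheory Module Filter Topology
open scoped ENNReal NNReal RealInnerProductSpace

noncomputable section
/-- `coverNumber A δ` is the least number of closed `δ`-balls needed to cover `A`
(`⊤` if no finite cover exists). -/
def coverNumber {X : Type*} [PseudoMetricSpace X] (A : Set X) (δ : ℝ) : ℕ∞ :=
  sInf {m : ℕ∞ | ∃ s : Finset X, (s.card : ℕ∞) = m ∧ A ⊆ ⋃ x ∈ s, Metric.closedBall x δ}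

/-- The upper box (Minkowski) dimension of a set in a metric space:
`limsup_{δ → 0⁺} log N(A,δ) / log (1/δ)`. -/
def upperBoxDim {X : Type*} [PseudoMetricSpace X] (A : Set X) : ℝ≥0∞ :=
  Filter.limsup (fun δ : ℝ =>
      if coverNumber A δ = ⊤ then (⊤ : ℝ≥0∞)
      else ENNReal.ofReal (Real.log ((coverNumber A δ).toNat) / Real.log (1 / δ)))
    (nhdsWithin 0 (Set.Ioi 0))

/-- The packing dimension of a set: the infimum, over countable decompositions of `A`
into bounded pieces, of the supremum of the upper box dimensions of the pieces. -/
def packingDim {X : Type*} [PseudoMetricSpace X] (A : Set X) : ℝ≥0∞ :=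
  ⨅ (C : ℕ → Set X) (_ : A = ⋃ i, C i) (_ : ∀ i, Bornology.IsBounded (C i)),
    ⨆ i, upperBoxDim (C i)

/-- The `s`-dimensional Hausdorff content of a set: the infimum of `∑ (diam Fᵢ)^s` over
countable covers of `A` (empty sets contributing `0`). -/
def hausdorffContent {X : Type*} [PseudoEMetricSpace X] (s : ℝ) (A : Set X) : ℝ≥0∞ :=
  ⨅ (F : ℕ → Set X) (_ : A ⊆ ⋃ i, F i),
    ∑' i, ⨆ (_ : (F i).Nonempty), EMetric.diam (F i) ^ s

/-- The closed unit cube `[0,1]ⁿ ⊆ ℝⁿ`. -/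
def unitCube (n : ℕ) : Set (EuclideanSpace ℝ (Fin n)) :=
  {x | ∀ i, x i ∈ Set.Icc (0 : ℝ) 1}

/-- `K'` is a miniset of `K`: a nonempty closed subset of `[0,1]ⁿ` contained in the image
of `K` under an expanding homothety `x ↦ r x + b`, `|r| ≥ 1`. -/
def IsMiniset {n : ℕ} (K K' : Set (EuclideanSpace ℝ (Fin n))) : Prop :=
  IsClosed K' ∧ K'.Nonempty ∧ K' ⊆ unitCube n ∧
    ∃ (r : ℝ) (b : EuclideanSpace ℝ (Fin n)), 1 ≤ |r| ∧ K' ⊆ (fun x => r • x + b) '' K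

/-- `K''` is a microset of `K`: a limit of minisets of `K` in the Hausdorff metric. -/
def IsMicroset {n : ℕ} (K K'' : Set (EuclideanSpace ℝ (Fin n))) : Prop :=
  IsClosed K'' ∧ K''.Nonempty ∧ K'' ⊆ unitCube n ∧
    ∃ Ks : ℕ → Set (EuclideanSpace ℝ (Fin n)), (∀ i, IsMiniset K (Ks i)) ∧
      Filter.Tendsto (fun i => Metric.hausdorffDist (Ks i) K'') Filter.atTop (nhds 0)

/-- A set `K ⊆ [0,1]ⁿ` is homogeneous if every microset of `K` is a miniset of `K`. -/
def IsHomogeneous {n : ℕ} (K : Set (EuclideanSpace ℝ (Fin n))) : Prop :=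
  K ⊆ unitCube n ∧ ∀ K'', IsMicroset K K'' → IsMiniset K K''

lemma coverNumber_le {X : Type*} [PseudoMetricSpace X] {A : Set X} {δ : ℝ} (s : Finset X)
    (h : A ⊆ ⋃ x ∈ s, Metric.closedBall x δ) : coverNumber A δ ≤ s.card :=
  sInf_le ⟨s, rfl, h⟩

lemma exists_cover_of_coverNumber_ne_top {X : Type*} [PseudoMetricSpace X] {A : Set X} {δ : ℝ}
    (h : coverNumber A δ ≠ ⊤) :
    ∃ s : Finset X, s.card = (coverNumber A δ).toNat ∧ A ⊆ ⋃ x ∈ s, Metric.closedBall x δ := by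
  have hne : {m : ℕ∞ | ∃ s : Finset X, (s.card : ℕ∞) = m ∧
      A ⊆ ⋃ x ∈ s, Metric.closedBall x δ}.Nonempty := by
    by_contra hc
    rw [Set.not_nonempty_iff_eq_empty] at hc
    apply h
    rw [coverNumber, hc, sInf_empty]
  obtain ⟨s, hs, hA⟩ := csInf_mem hne
  refine ⟨s, ?_, hA⟩
  change (s.card : ℕ∞) = coverNumber A δ at hs
  rw [← hs]; rfl

/-- A polynomial bound on covering numbers bounds the upper box dimension. -/
lemma upperBoxDim_le_of_cover {X : Type*} [PseudoMetricSpace X] {A : Set X} {C : ℝ} {t : ℝ≥0}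
    (hC : 1 ≤ C)
    (h : ∀ δ : ℝ, 0 < δ → δ ≤ 1 → ∃ s : Finset X, (s.card : ℝ) ≤ C * δ⁻¹ ^ (t : ℝ) ∧
      A ⊆ ⋃ x ∈ s, Metric.closedBall x δ) : upperBoxDim A ≤ t := by
  have hlog : Tendsto (fun δ : ℝ => Real.log (1 / δ)) (𝓝[>] 0) atTop := by
    simp only [one_div]
    exact Real.tendsto_log_atTop.comp tendsto_inv_nhdsGT_zero
  have hlim : Tendsto (fun δ : ℝ => ENNReal.ofReal (Real.log C / Real.log (1 / δ) + t))
      (𝓝[>] 0) (𝓝 (t : ℝ≥0∞)) := by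
    have : Tendsto (fun δ : ℝ => Real.log C / Real.log (1 / δ) + (t : ℝ)) (𝓝[>] 0)
        (𝓝 (0 + t)) := (hlog.const_div_atTop _).add_const _
    rw [zero_add] at this
    have h2 := ENNReal.tendsto_ofReal this
    rwa [ENNReal.ofReal_coe_nnreal] at h2
  rw [← hlim.limsup_eq]
  refine limsup_le_limsup ?_
  have h1 : ∀ᶠ δ : ℝ in 𝓝[>] 0, δ < 1 :=
    nhdsWithin_le_nhds (Iio_mem_nhds one_pos)
  filter_upwards [h1, self_mem_nhdsWithin] with δ hδ1 hδ0
  have hδ0 : 0 < δ := hδ0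
  obtain ⟨s, hs, hA⟩ := h δ hδ0 hδ1.le
  have hle := coverNumber_le s hA
  have hnt : coverNumber A δ ≠ ⊤ := ne_top_of_le_ne_top (ENat.natCast_ne_top _) hle
  rw [if_neg hnt]
  apply ENNReal.ofReal_le_ofReal
  have hL : 0 < Real.log (1 / δ) := Real.log_pos (by rw [lt_div_iff₀ hδ0]; linarith)
  have hn : ((coverNumber A δ).toNat : ℝ) ≤ C * δ⁻¹ ^ (t : ℝ) := by
    refine le_trans ?_ hs
    exact_mod_cast ENat.toNat_le_of_le_natCast hle
  rw [div_add' _ _ _ hL.ne', div_le_div_iff_of_pos_right hL]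
  rcases Nat.eq_zero_or_pos (coverNumber A δ).toNat with h0 | h0
  · rw [h0]; simp only [Nat.cast_zero, Real.log_zero]
    have := Real.log_nonneg hC
    positivity
  · calc Real.log ((coverNumber A δ).toNat) ≤ Real.log (C * δ⁻¹ ^ (t : ℝ)) :=
          Real.log_le_log (by exact_mod_cast h0) hn
      _ = _ := by
          rw [Real.log_mul (by linarith) (by positivity), Real.log_rpow (by positivity), one_div]

lemma dimH_le_upperBoxDim {n : ℕ} (A : Set (EuclideanSpace ℝ (Fin n))) :
    dimH A ≤ upperBoxDim A := by
  refine le_of_forall_gt_imp_ge_of_dense fun a ha => ?_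
  obtain ⟨s, hs1, hs2⟩ := ENNReal.lt_iff_exists_nnreal_btwn.1 ha
  refine le_trans ?_ hs2.le
  apply dimH_le_of_hausdorffMeasure_ne_top
  have hev := eventually_lt_of_limsup_lt hs1
  have h1 : ∀ᶠ δ : ℝ in 𝓝[>] 0, δ < 1 :=
    nhdsWithin_le_nhds (Iio_mem_nhds one_pos)
  have key : ∀ᶠ δ : ℝ in 𝓝[>] 0, ∃ u : Finset (EuclideanSpace ℝ (Fin n)),
      0 < δ ∧ (u.card : ℝ) ≤ δ⁻¹ ^ (s : ℝ) ∧ A ⊆ ⋃ x ∈ u, Metric.closedBall x δ := by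
    filter_upwards [hev, h1, self_mem_nhdsWithin] with δ h2 hδ1 hδ0
    have hδ0 : 0 < δ := hδ0
    have hnt : coverNumber A δ ≠ ⊤ := by
      intro h; rw [if_pos h] at h2; exact not_top_lt h2
    rw [if_neg hnt] at h2
    obtain ⟨u, hu, hA⟩ := exists_cover_of_coverNumber_ne_top hnt
    refine ⟨u, hδ0, ?_, hA⟩
    rw [hu]
    have hL : 0 < Real.log (1 / δ) := Real.log_pos (by rw [lt_div_iff₀ hδ0]; linarith)
    have h3 : Real.log ((coverNumber A δ).toNat) / Real.log (1 / δ) ≤ s := by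
      have := ENNReal.toReal_mono ENNReal.coe_ne_top h2.le
      exact (ENNReal.toReal_ofReal (div_nonneg (Real.log_natCast_nonneg _) hL.le)) ▸ this
    rw [div_le_iff₀ hL] at h3
    rcases Nat.eq_zero_or_pos (coverNumber A δ).toNat with h0 | h0
    · rw [h0]; simp only [Nat.cast_zero]; positivity
    · rw [← Real.log_le_log_iff (by exact_mod_cast h0) (by positivity),
        Real.log_rpow (by positivity), ← one_div]
      exact h3
  have key' : ∀ δ : ℝ, ∃ u : Finset (EuclideanSpace ℝ (Fin n)), (∃ u : Finset (EuclideanSpace ℝ (Fin n)),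
      0 < δ ∧ (u.card : ℝ) ≤ δ⁻¹ ^ (s : ℝ) ∧ A ⊆ ⋃ x ∈ u, Metric.closedBall x δ) → 
      0 < δ ∧ (u.card : ℝ) ≤ δ⁻¹ ^ (s : ℝ) ∧ A ⊆ ⋃ x ∈ u, Metric.closedBall x δ := by
    intro δ
    by_cases h : ∃ u : Finset (EuclideanSpace ℝ (Fin n)),
      0 < δ ∧ (u.card : ℝ) ≤ δ⁻¹ ^ (s : ℝ) ∧ A ⊆ ⋃ x ∈ u, Metric.closedBall x δ
    · obtain ⟨u, hu⟩ := h; exact ⟨u, fun _ => hu⟩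
    · exact ⟨∅, fun h' => absurd h' h⟩
  choose u hu using key'
  have hdiam : ∀ (x : EuclideanSpace ℝ (Fin n)) (δ : ℝ), 
      ediam (Metric.closedBall x δ) ≤ ENNReal.ofReal (2 * δ) := by
    intro x δ
    refine Metric.ediam_le fun y hy z hz => ?_
    rw [edist_dist]
    apply ENNReal.ofReal_le_ofReal
    have := dist_triangle_right y z x
    have h1 : dist y x ≤ δ := hy
    have h2 : dist z x ≤ δ := hz
    linarith
  have hmain := Measure.hausdorffMeasure_le_liminf_sum (ι := fun δ : ℝ => u δ) (s : ℝ) A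
    (l := 𝓝[>] (0 : ℝ)) (fun δ => ENNReal.ofReal (2 * δ)) (by
      have : Tendsto (fun δ : ℝ => 2 * δ) (𝓝[>] 0) (𝓝 (2 * 0)) :=
        (tendsto_id.const_mul 2).mono_left nhdsWithin_le_nhds
      have h2 := ENNReal.tendsto_ofReal this
      simpa using h2)
    (fun δ x => Metric.closedBall (x : EuclideanSpace ℝ (Fin n)) δ)
    (Eventually.of_forall fun δ x => hdiam _ _)
    (by
      filter_upwards [key] with δ hδ
      refine (hu δ hδ).2.2.trans ?_
      exact iUnion₂_subset fun x hx => subset_iUnion_of_subset ⟨x, hx⟩ subset_rfl)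
  refine ne_top_of_le_ne_top (ENNReal.ofReal_ne_top (r := 2 ^ (s : ℝ))) (hmain.trans ?_)
  refine (liminf_le_liminf (v := fun _ => ENNReal.ofReal (2 ^ (s : ℝ))) ?_).trans
    (by simp)
  filter_upwards [key] with δ hδ
  obtain ⟨hδ0, hc, -⟩ := hu δ hδ
  calc ∑ x : u δ, ediam (Metric.closedBall (x : EuclideanSpace ℝ (Fin n)) δ) ^ (s : ℝ)
      ≤ ∑ x : u δ, ENNReal.ofReal (2 * δ) ^ (s : ℝ) :=
        Finset.sum_le_sum fun x _ => ENNReal.rpow_le_rpow (hdiam _ _) s.2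
    _ = ENNReal.ofReal ((u δ).card * (2 * δ) ^ (s : ℝ)) := by
        rw [ENNReal.ofReal_rpow_of_nonneg (by positivity) s.coe_nonneg, Finset.sum_const, 
          ENNReal.ofReal_mul (by positivity)]
        simp
    _ ≤ _ := by
        apply ENNReal.ofReal_le_ofReal
        calc ((u δ).card : ℝ) * (2 * δ) ^ (s : ℝ) ≤ δ⁻¹ ^ (s : ℝ) * (2 * δ) ^ (s : ℝ) := by gcongr
          _ = 2 ^ (s : ℝ) := by
            rw [← Real.mul_rpow (by positivity) (by positivity)]
            congr 1; field_simp

/-- Compact sets of zero Hausdorff measure have good finite covers by balls. -/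
lemma exists_finite_cover {n : ℕ} {M : Set (EuclideanSpace ℝ (Fin n))} (hM : IsCompact M)
    {t : ℝ} (ht : 0 < t) (h0 : μH[t] M = 0) :
    ∃ (F : Finset ℕ) (x : ℕ → EuclideanSpace ℝ (Fin n)) (ρ : ℕ → ℝ),
      (∀ i, 0 < ρ i ∧ ρ i ≤ 1 / 4) ∧ ∑ i ∈ F, (2 * ρ i) ^ t ≤ 1 ∧
      M ⊆ ⋃ i ∈ F, Metric.ball (x i) (ρ i) := by
  set ε : ℝ := (4 ^ t)⁻¹ / 2 with hε
  have hεpos : 0 < ε := by positivity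
  rw [Measure.hausdorffMeasure_apply] at h0
  have h1 : (⨅ (T : ℕ → Set (EuclideanSpace ℝ (Fin n))) (_ : M ⊆ ⋃ n, T n)
      (_ : ∀ n, ediam (T n) ≤ ENNReal.ofReal (1 / 8)),
      ∑' n, ⨆ _ : (T n).Nonempty, ediam (T n) ^ t) < ENNReal.ofReal ε := by
    refine lt_of_le_of_lt ?_ (ENNReal.ofReal_pos.2 hεpos)
    rw [← h0]
    exact le_iSup₂_of_le (ENNReal.ofReal (1 / 8)) (by simp) le_rfl
  simp only [iInf_lt_iff] at h1
  obtain ⟨T, hMT, hTd, hTs⟩ := h1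
  have hη : ∀ i : ℕ, ∃ η : ℝ, 0 < η ∧ η ≤ 1 / 4 ∧ (2 * η) ^ t ≤ (1 / 2) ^ i / 4 := by
    intro i
    have hc : (0 : ℝ) < (1 / 2) ^ i / 4 := by positivity
    refine ⟨min (1 / 4) (((1 / 2) ^ i / 4) ^ (t⁻¹) / 2), by positivity, min_le_left _ _, ?_⟩
    calc (2 * min (1 / 4) ((((1 : ℝ) / 2) ^ i / 4) ^ (t⁻¹) / 2)) ^ t
        ≤ (2 * ((((1 : ℝ) / 2) ^ i / 4) ^ (t⁻¹) / 2)) ^ t := by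
          gcongr
          exact min_le_right _ _
      _ = _ := by
          rw [mul_div_cancel₀ _ two_ne_zero, Real.rpow_inv_rpow hc.le ht.ne']
  choose η hη0 hη1 hη2 using hη
  set d : ℕ → ℝ := fun i => (ediam (T i)).toReal with hd
  have hdtop : ∀ i, ediam (T i) ≠ ⊤ := fun i => ne_top_of_le_ne_top ENNReal.ofReal_ne_top (hTd i)
  have hd0 : ∀ i, 0 ≤ d i := fun i => ENNReal.toReal_nonneg
  have hd8 : ∀ i, d i ≤ 1 / 8 := fun i => ENNReal.toReal_le_of_le_ofReal (by norm_num) (hTd i)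
  have hdsum : ∀ F : Finset ℕ, ∑ i ∈ F, d i ^ t ≤ ε := by
    intro F
    rw [← ENNReal.ofReal_le_ofReal_iff hεpos.le]
    refine le_trans ?_ hTs.le
    rw [ENNReal.ofReal_sum_of_nonneg (fun i _ => Real.rpow_nonneg (hd0 i) _)]
    refine le_trans (Finset.sum_le_sum fun i _ => ?_) (ENNReal.sum_le_tsum F)
    rw [← ENNReal.ofReal_rpow_of_nonneg (hd0 i) ht.le, ENNReal.ofReal_toReal (hdtop i)]
    rcases (T i).eq_empty_or_nonempty with h | h
    · simp [h, ht]
    · exact le_iSup_of_le h le_rfl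
  have hx : ∀ i, ∃ x, T i ⊆ Metric.ball x (max (2 * d i) (η i)) := by
    intro i
    rcases (T i).eq_empty_or_nonempty with h | ⟨x, hx⟩
    · exact ⟨0, by simp [h]⟩
    · refine ⟨x, fun y hy => ?_⟩
      rw [Metric.mem_ball, dist_edist]
      have h1 : (edist y x).toReal ≤ d i :=
        ENNReal.toReal_mono (hdtop i) (Metric.edist_le_ediam_of_mem hy hx)
      rcases (hd0 i).eq_or_lt with h | h
      · exact lt_max_of_lt_right (by linarith [hη0 i])
      · exact lt_max_of_lt_left (by linarith)
  choose x hx using hx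
  obtain ⟨F, hF⟩ := hM.elim_finite_subcover (fun i => Metric.ball (x i) (max (2 * d i) (η i)))
    (fun i => Metric.isOpen_ball) (hMT.trans (iUnion_mono hx))
  refine ⟨F, x, fun i => max (2 * d i) (η i), fun i => ⟨lt_max_of_lt_right (hη0 i),
    max_le (by linarith [hd8 i]) (hη1 i)⟩, ?_, hF⟩
  have hgeo : ∑ i ∈ F, ((1 : ℝ) / 2) ^ i / 4 ≤ 1 / 2 := by
    rw [← Finset.sum_div]
    have := Summable.sum_le_tsum F (fun i _ => by positivity) summable_geometric_two
    rw [tsum_geometric_two] at this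
    linarith
  calc ∑ i ∈ F, (2 * max (2 * d i) (η i)) ^ t
      ≤ ∑ i ∈ F, (4 ^ t * d i ^ t + (1 / 2) ^ i / 4) := by
        refine Finset.sum_le_sum fun i _ => ?_
        have hh : (0 : ℝ) ≤ 4 ^ t * d i ^ t := mul_nonneg (by positivity) (Real.rpow_nonneg (hd0 i) _)
        rcases max_cases (2 * d i) (η i) with ⟨h, -⟩ | ⟨h, -⟩
        · rw [h, ← mul_assoc, Real.mul_rpow (by norm_num) (hd0 i)]
          have : (0 : ℝ) ≤ (1 / 2) ^ i / 4 := by positivity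
          norm_num at this ⊢
          linarith
        · rw [h]; linarith [hη2 i]
    _ = 4 ^ t * ∑ i ∈ F, d i ^ t + ∑ i ∈ F, (1 / 2) ^ i / 4 := by
        rw [Finset.sum_add_distrib, Finset.mul_sum]
    _ ≤ 4 ^ t * ε + 1 / 2 := by gcongr; exact hdsum F
    _ = 1 := by rw [hε]; field_simp; norm_num

lemma isCompact_unitCube (n : ℕ) : IsCompact (unitCube n) := by
  have h : unitCube n = (EuclideanSpace.equiv (Fin n) ℝ).toHomeomorph ⁻¹'
      (Set.pi univ fun _ => Set.Icc (0 : ℝ) 1) := by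
    ext x
    simp only [unitCube, mem_ofPred_eq, mem_preimage, Set.mem_pi, mem_univ, forall_true_left]
    rfl
  rw [h, Homeomorph.isCompact_preimage]
  exact isCompact_univ_pi fun _ => isCompact_Icc

lemma IsMiniset.isCompact {n : ℕ} {K M : Set (EuclideanSpace ℝ (Fin n))} (h : IsMiniset K M) :
    IsCompact M := (isCompact_unitCube n).of_isClosed_subset h.1 h.2.2.1

lemma IsMiniset.dimH_le {n : ℕ} {K M : Set (EuclideanSpace ℝ (Fin n))} (h : IsMiniset K M) :
    dimH M ≤ dimH K := by
  obtain ⟨-, -, -, r, b, -, hM⟩ := h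
  refine (dimH_mono hM).trans ?_
  have : LipschitzWith ‖r‖₊ (fun x : EuclideanSpace ℝ (Fin n) => r • x + b) := by
    refine LipschitzWith.of_dist_le_mul fun x y => ?_
    rw [dist_add_right, dist_smul₀]; rfl
  exact this.dimH_image_le K

/-- Uniform covers of all minisets. -/
lemma exists_uniform_cover {n : ℕ} {K : Set (EuclideanSpace ℝ (Fin n))}
    (hK : IsHomogeneous K) {t : ℝ≥0} (ht : dimH K < t) :
    ∃ δ₀ : ℝ, 0 < δ₀ ∧ ∀ M, IsMiniset K M →
      ∃ (F : Finset ℕ) (x : ℕ → EuclideanSpace ℝ (Fin n)) (ρ : ℕ → ℝ),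
      (∀ i ∈ F, δ₀ ≤ ρ i ∧ ρ i ≤ 1 / 4) ∧ ∑ i ∈ F, (2 * ρ i) ^ (t : ℝ) ≤ 1 ∧
      M ⊆ ⋃ i ∈ F, Metric.closedBall (x i) (ρ i) := by
  by_contra hcon
  push Not at hcon
  have hcon' : ∀ j : ℕ, ∃ M, IsMiniset K M ∧ 
      ∀ (F : Finset ℕ) (x : ℕ → EuclideanSpace ℝ (Fin n)) (ρ : ℕ → ℝ),
      (∀ i ∈ F, 1 / ((j : ℝ) + 1) ≤ ρ i ∧ ρ i ≤ 1 / 4) → ∑ i ∈ F, (2 * ρ i) ^ (t : ℝ) ≤ 1 →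
      ¬ M ⊆ ⋃ i ∈ F, Metric.closedBall (x i) (ρ i) := 
    fun j => hcon _ (by positivity)
  choose M hM hbad using hcon'
  let L : ℕ → TopologicalSpace.NonemptyCompacts (EuclideanSpace ℝ (Fin n)) :=
    fun j => ⟨⟨M j, (hM j).isCompact⟩, (hM j).2.1⟩
  have hcpt : IsCompact {L : TopologicalSpace.NonemptyCompacts (EuclideanSpace ℝ (Fin n)) |
      (L : Set (EuclideanSpace ℝ (Fin n))) ⊆ unitCube n} :=
    TopologicalSpace.NonemptyCompacts.isCompact_subsets_of_isCompact (isCompact_unitCube n)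
  obtain ⟨N, hN, φ, hφ, hlim⟩ := hcpt.tendsto_subseq (x := L) (fun j => (hM j).2.2.1)
  have hmicro : IsMicroset K (N : Set (EuclideanSpace ℝ (Fin n))) := by
    refine ⟨N.isCompact.isClosed, N.nonempty, hN, fun j => M (φ j), fun j => hM _, ?_⟩
    exact tendsto_iff_dist_tendsto_zero.1 hlim
  have hmini := hK.2 _ hmicro
  have ht0 : (0 : ℝ) < t := by
    have : (0 : ℝ≥0∞) < t := lt_of_le_of_lt (zero_le) ht
    exact_mod_cast this
  have hzero : μH[(t : ℝ)] (N : Set (EuclideanSpace ℝ (Fin n))) = 0 :=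
    hausdorffMeasure_of_dimH_lt (lt_of_le_of_lt hmini.dimH_le ht)
  obtain ⟨F, x, ρ, hρ, hsum, hcov⟩ := exists_finite_cover N.isCompact ht0 hzero
  obtain ⟨ε, hε, hthick⟩ := N.isCompact.exists_thickening_subset_open
    (isOpen_biUnion fun i _ => Metric.isOpen_ball) hcov
  have hmin : ∃ m : ℝ, 0 < m ∧ ∀ i ∈ F, m ≤ ρ i := by
    rcases F.eq_empty_or_nonempty with h | h
    · exact ⟨1, one_pos, by simp [h]⟩
    · exact ⟨F.inf' h ρ, (Finset.lt_inf'_iff h).2 fun i _ => (hρ i).1,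
        fun i hi => Finset.inf'_le _ hi⟩
  obtain ⟨m, hm, hmρ⟩ := hmin
  have e1 : ∀ᶠ j in atTop, 1 / ((φ j : ℝ) + 1) < m :=
    (tendsto_one_div_add_atTop_nhds_zero_nat.comp hφ.tendsto_atTop).eventually_lt_const hm
  have e2 : ∀ᶠ j in atTop, dist ((L ∘ φ) j) N < ε :=
    (tendsto_iff_dist_tendsto_zero.1 hlim).eventually_lt_const hε
  obtain ⟨j, hj1, hj2⟩ := (e1.and e2).exists
  refine hbad (φ j) F x ρ (fun i hi => ⟨hj1.le.trans (hmρ i hi), (hρ i).2⟩) hsum ?_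
  intro y hy
  have hfin : hausdorffEDist (M (φ j)) (N : Set (EuclideanSpace ℝ (Fin n))) ≠ ⊤ :=
    hausdorffEDist_ne_top_of_nonempty_of_bounded (hM _).2.1 N.nonempty
      (hM _).isCompact.isBounded N.isCompact.isBounded
  obtain ⟨z, hz, hyz⟩ := exists_dist_lt_of_hausdorffDist_lt hy hj2 hfin
  have := hthick (Metric.mem_thickening_iff.2 ⟨z, hz, hyz⟩)
  simp only [mem_iUnion] at this ⊢
  obtain ⟨i, hi, h⟩ := this
  exact ⟨i, hi, Metric.ball_subset_closedBall h⟩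

/-- Blowing up the part of a miniset in a small ball gives a miniset. -/
lemma IsMiniset.blowup {n : ℕ} {K M : Set (EuclideanSpace ℝ (Fin n))} (h : IsMiniset K M)
    (x : EuclideanSpace ℝ (Fin n)) {ρ : ℝ} (hρ : 0 < ρ) (hρ4 : ρ ≤ 1 / 4)
    (hne : (M ∩ Metric.closedBall x ρ).Nonempty) :
    ∃ b : EuclideanSpace ℝ (Fin n),
      IsMiniset K ((fun y => (2 * ρ)⁻¹ • y + b) '' (M ∩ Metric.closedBall x ρ)) := by
  set h2 : EuclideanSpace ℝ (Fin n) := WithLp.toLp 2 (fun _ => (1 / 2 : ℝ)) with hh2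
  refine ⟨h2 - (2 * ρ)⁻¹ • x, ?_, hne.image _, ?_, ?_⟩
  · exact ((h.isCompact.inter_right Metric.isClosed_closedBall).image (by fun_prop)).isClosed
  · rintro _ ⟨y, ⟨-, hy⟩, rfl⟩ i
    have h1 : |y i - x i| ≤ ρ := by
      have := PiLp.norm_apply_le (y - x) i
      rw [Metric.mem_closedBall, dist_eq_norm] at hy
      exact this.trans hy
    have h3 : ((2 * ρ)⁻¹ • y + (h2 - (2 * ρ)⁻¹ • x)) i = (2 * ρ)⁻¹ * (y i - x i) + 1 / 2 := by
      simp [hh2]; ring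
    change ((2 * ρ)⁻¹ • y + (h2 - (2 * ρ)⁻¹ • x)) i ∈ Icc (0 : ℝ) 1
    rw [h3]
    have h4 : |(2 * ρ)⁻¹ * (y i - x i)| ≤ 1 / 2 := by
      rw [abs_mul, abs_of_pos (by positivity : 0 < (2 * ρ)⁻¹)]
      calc (2 * ρ)⁻¹ * |y i - x i| ≤ (2 * ρ)⁻¹ * ρ := by gcongr
        _ = 1 / 2 := by field_simp
    rw [abs_le] at h4
    constructor <;> linarith
  · obtain ⟨-, -, -, r, b, hr, hM⟩ := h
    refine ⟨(2 * ρ)⁻¹ * r, (2 * ρ)⁻¹ • b + (h2 - (2 * ρ)⁻¹ • x), ?_, ?_⟩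
    · rw [abs_mul, abs_of_pos (by positivity : 0 < (2 * ρ)⁻¹)]
      have : 1 ≤ (2 * ρ)⁻¹ := (one_le_inv₀ (by positivity)).2 (by linarith)
      nlinarith
    · rintro _ ⟨y, ⟨hy, -⟩, rfl⟩
      obtain ⟨k, hk, rfl⟩ := hM hy
      refine ⟨k, hk, ?_⟩
      simp only [smul_add, smul_smul]
      abel

lemma cover_bound {n : ℕ} {K : Set (EuclideanSpace ℝ (Fin n))}
    {t δ₀ C : ℝ} (hδ₀ : 0 < δ₀) (ht : 0 < t) (hC : 1 ≤ C)
    (hunif : ∀ M, IsMiniset K M →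
      ∃ (F : Finset ℕ) (x : ℕ → EuclideanSpace ℝ (Fin n)) (ρ : ℕ → ℝ),
      (∀ i ∈ F, δ₀ ≤ ρ i ∧ ρ i ≤ 1 / 4) ∧ ∑ i ∈ F, (2 * ρ i) ^ t ≤ 1 ∧
      M ⊆ ⋃ i ∈ F, Metric.closedBall (x i) (ρ i))
    (hbase : ∃ s : Finset (EuclideanSpace ℝ (Fin n)), (s.card : ℝ) ≤ C ∧
      unitCube n ⊆ ⋃ x ∈ s, Metric.closedBall x δ₀) (k : ℕ) :
    ∀ δ : ℝ, 0 < δ → δ ≤ 1 → δ₀ ≤ 2 ^ k * δ → ∀ M, IsMiniset K M →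
      ∃ s : Finset (EuclideanSpace ℝ (Fin n)), (s.card : ℝ) ≤ C * δ⁻¹ ^ t ∧
        M ⊆ ⋃ x ∈ s, Metric.closedBall x δ := by
  classical
  have base : ∀ δ : ℝ, 0 < δ → δ ≤ 1 → δ₀ ≤ δ → ∀ M, IsMiniset K M →
      ∃ s : Finset (EuclideanSpace ℝ (Fin n)), (s.card : ℝ) ≤ C * δ⁻¹ ^ t ∧
        M ⊆ ⋃ x ∈ s, Metric.closedBall x δ := by
    intro δ hδ hδ1 hδδ M hM
    obtain ⟨s, hs, hcov⟩ := hbase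
    refine ⟨s, ?_, (hM.2.2.1.trans hcov).trans ?_⟩
    · have : 1 ≤ δ⁻¹ ^ t := Real.one_le_rpow ((one_le_inv₀ hδ).2 hδ1) ht.le
      nlinarith
    · exact iUnion₂_mono fun x _ => Metric.closedBall_subset_closedBall hδδ
  induction k with
  | zero => 
    intro δ hδ hδ1 h
    exact base δ hδ hδ1 (by simpa using h)
  | succ k ih =>
    intro δ hδ hδ1 h M hM
    rcases le_or_gt δ₀ δ with hlt | hlt
    · exact base δ hδ hδ1 hlt M hM
    obtain ⟨F, x, ρ, hρ, hsum, hcov⟩ := hunif M hM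
    have piece : ∀ i, ∃ s : Finset (EuclideanSpace ℝ (Fin n)), i ∈ F →
        (s.card : ℝ) ≤ C * δ⁻¹ ^ t * (2 * ρ i) ^ t ∧
        M ∩ Metric.closedBall (x i) (ρ i) ⊆ ⋃ x ∈ s, Metric.closedBall x δ := by
      intro i
      by_cases hi : i ∈ F
      swap
      · exact ⟨∅, fun h => absurd h hi⟩
      obtain ⟨hρ1, hρ2⟩ := hρ i hi
      have hρ0 : 0 < ρ i := hδ₀.trans_le hρ1
      rcases (M ∩ Metric.closedBall (x i) (ρ i)).eq_empty_or_nonempty with he | hne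
      · refine ⟨∅, fun _ => ⟨?_, by simp [he]⟩⟩
        simp only [Finset.card_empty, Nat.cast_zero]
        positivity
      obtain ⟨b, hb⟩ := hM.blowup (x i) hρ0 hρ2 hne
      obtain ⟨s, hs, hsc⟩ := ih (δ / (2 * ρ i)) (by positivity)
        (by rw [div_le_one (by positivity)]; linarith)
        (by
          refine h.trans ?_
          rw [pow_succ, mul_assoc]
          have : 2 * δ ≤ δ / (2 * ρ i) := by
            rw [le_div_iff₀ (by positivity)]; nlinarith
          gcongr) _ hb
      refine ⟨s.image (fun y => (2 * ρ i) • (y - b)), fun _ => ⟨?_, ?_⟩⟩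
      · refine le_trans (by exact_mod_cast Finset.card_image_le) (hs.trans (le_of_eq ?_))
        rw [mul_assoc, ← Real.mul_rpow (by positivity) (by positivity)]
        congr 2
        field_simp
      · intro y hy
        have := hsc ⟨y, hy, rfl⟩
        simp only [mem_iUnion] at this
        obtain ⟨z, hz, hyz⟩ := this
        simp only [mem_iUnion]
        refine ⟨_, Finset.mem_image_of_mem _ hz, ?_⟩
        rw [Metric.mem_closedBall, dist_eq_norm] at hyz ⊢
        have e : y - (2 * ρ i) • (z - b) = (2 * ρ i) • ((2 * ρ i)⁻¹ • y + b - z) := by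
          have : (2 * ρ i) • (2 * ρ i)⁻¹ • y = y := smul_inv_smul₀ (by positivity) y
          rw [smul_sub, smul_sub, smul_add, this]
          abel
        rw [e, norm_smul, Real.norm_of_nonneg (by positivity)]
        rwa [le_div_iff₀' (by positivity)] at hyz
    choose s hs using piece
    refine ⟨F.biUnion s, ?_, ?_⟩
    · calc ((F.biUnion s).card : ℝ) ≤ ∑ i ∈ F, ((s i).card : ℝ) := by
            exact_mod_cast Finset.card_biUnion_le
        _ ≤ ∑ i ∈ F, C * δ⁻¹ ^ t * (2 * ρ i) ^ t := Finset.sum_le_sum fun i hi => (hs i hi).1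
        _ = C * δ⁻¹ ^ t * ∑ i ∈ F, (2 * ρ i) ^ t := by rw [Finset.mul_sum]
        _ ≤ C * δ⁻¹ ^ t * 1 := by gcongr
        _ = _ := mul_one _
    · intro y hy
      have := hcov hy
      simp only [mem_iUnion] at this
      obtain ⟨i, hi, hyi⟩ := this
      have := (hs i hi).2 ⟨hy, hyi⟩
      simp only [mem_iUnion] at this ⊢
      obtain ⟨z, hz, h⟩ := this
      exact ⟨z, Finset.mem_biUnion.2 ⟨i, hi, hz⟩, h⟩

/-- A homogeneous compact set has equal Hausdorff and upper box dimensions. -/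
theorem homogeneous_dimH_eq_upperBoxDim {n : ℕ} (K : Set (EuclideanSpace ℝ (Fin n)))
    (hKc : IsCompact K) (hK : IsHomogeneous K) : dimH K = upperBoxDim K := by
  refine le_antisymm (dimH_le_upperBoxDim K) ?_
  refine le_of_forall_gt_imp_ge_of_dense fun a ha => ?_
  obtain ⟨t, ht1, ht2⟩ := ENNReal.lt_iff_exists_nnreal_btwn.1 ha
  refine le_trans ?_ ht2.le
  have ht0 : (0 : ℝ) < t := by
    have : (0 : ℝ≥0∞) < t := lt_of_le_of_lt (zero_le) ht1
    exact_mod_cast this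
  rcases K.eq_empty_or_nonempty with rfl | hne
  · refine upperBoxDim_le_of_cover (C := 1) le_rfl fun δ hδ _ => ⟨∅, ?_, by simp⟩
    simp only [Finset.card_empty, Nat.cast_zero]
    positivity
  obtain ⟨δ₀, hδ₀, hunif⟩ := exists_uniform_cover hK ht1
  obtain ⟨s, -, hsf, hs⟩ := (isCompact_unitCube n).finite_cover_balls hδ₀
  have hbase : ∃ s : Finset (EuclideanSpace ℝ (Fin n)),
      (s.card : ℝ) ≤ (hsf.toFinset.card : ℝ) + 1 ∧
      unitCube n ⊆ ⋃ x ∈ s, Metric.closedBall x δ₀ := by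
    refine ⟨hsf.toFinset, by linarith, hs.trans ?_⟩
    simp only [Set.Finite.mem_toFinset]
    exact iUnion₂_mono fun x _ => Metric.ball_subset_closedBall
  have hC : (1 : ℝ) ≤ (hsf.toFinset.card : ℝ) + 1 := by simp
  refine upperBoxDim_le_of_cover hC fun δ hδ hδ1 => ?_
  obtain ⟨k, hk⟩ := pow_unbounded_of_one_lt (δ₀ / δ) (one_lt_two (α := ℝ))
  refine cover_bound hδ₀ ht0 hC hunif hbase k δ hδ hδ1 ((div_le_iff₀ hδ).1 hk.le) K ?_
  exact ⟨hKc.isClosed, hne, hK.1, 1, 0, by simp, by simp⟩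

end
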